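/- arXiv:2512.04861 — 9 statements merged into one kernel-verified Lean document; each statement's English description precedes it below -/
import Mathlib

section
/- Let d be a positive integer, γ ∈ (1/4, 1/2), and η ∈ (0, 1/2). If t > 0 satisfies t^{γ−1/2}/√2 ≥ √d + √(2 log(10/η)), then the Gaussian tail fraction at bandwidth 2t with integration radius r₀ = t^γ satisfies α(2t) = 1 − (∫_{{z ∈ ℝ^d : ‖z‖ ≤ t^γ}} e^{−‖z‖²/(2t)} dz)/(π^{d/2} (2t)^{d/2}) ≤ η/10. -/
open MeasureTheory Real

section GaussianTail

variable {V : Type*} [NormedAddCommGroup V] [InnerProductSpace ℝ V] [FiniteDimensional ℝ V]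
  [MeasurableSpace V] [BorelSpace V]

theorem integrable_rexp_neg_mul_sq_norm {b : ℝ} (hb : 0 < b) :
    Integrable (fun v : V => rexp (-b * ‖v‖ ^ 2)) := by
  apply Integrable.of_integral_ne_zero
  rw [GaussianFourier.integral_rexp_neg_mul_sq_norm hb]
  positivity

/-- Chernoff bound, with exponent half the rate, for the Gaussian mass outside a ball. -/
theorem setIntegral_compl_closedBall_rexp_neg_mul_sq_norm_le {b r : ℝ} (hb : 0 < b)
    (hr : 0 ≤ r) :
    ∫ v in (Metric.closedBall (0 : V) r)ᶜ, rexp (-b * ‖v‖ ^ 2)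
      ≤ rexp (-(b / 2) * r ^ 2) * (π / (b / 2)) ^ (Module.finrank ℝ V / 2 : ℝ) := by
  have hb2 : 0 < b / 2 := by positivity
  have hint := (integrable_rexp_neg_mul_sq_norm (V := V) hb2).const_mul (rexp (-(b / 2) * r ^ 2))
  rw [← GaussianFourier.integral_rexp_neg_mul_sq_norm (V := V) hb2, ← integral_const_mul]
  refine le_trans (setIntegral_mono_on (integrable_rexp_neg_mul_sq_norm hb).integrableOn
    hint.integrableOn Metric.isClosed_closedBall.measurableSet.compl fun v hv => ?_)
    (setIntegral_le_integral hint (Filter.Eventually.of_forall fun v => by positivity))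
  have hv' : r < ‖v‖ := by simpa using hv
  rw [← Real.exp_add, Real.exp_le_exp]
  have : r ^ 2 ≤ ‖v‖ ^ 2 := by gcongr
  nlinarith

end GaussianTail

theorem two_rpow_le_exp {x : ℝ} (hx : 0 ≤ x) : (2 : ℝ) ^ x ≤ rexp x := by
  rw [← Real.exp_one_rpow]
  exact Real.rpow_le_rpow (by norm_num) (by linarith [Real.exp_one_gt_d9]) hx

/-- Gaussian tail fraction bound.
Let `d` be a positive integer, `γ ∈ (1/4, 1/2)`, and `η ∈ (0, 1/2)`. If `t > 0`
satisfies `t^{γ−1/2}/√2 ≥ √d + √(2 log(10/η))`, then the Gaussian tail fraction at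
bandwidth `2t` with integration radius `r₀ = t^γ` satisfies `α(2t) ≤ η/10`. -/
theorem gaussian_tail_fraction_bound
    (d : ℕ) (hd : 0 < d) (γ η t : ℝ)
    (hγ : γ ∈ Set.Ioo (1/4 : ℝ) (1/2)) (hη : η ∈ Set.Ioo (0 : ℝ) (1/2))
    (ht : 0 < t)
    (hcond : Real.sqrt d + Real.sqrt (2 * Real.log (10 / η))
      ≤ t ^ (γ - 1/2) / Real.sqrt 2) :
    1 - (∫ z in Metric.closedBall (0 : EuclideanSpace ℝ (Fin d)) (t ^ γ),
          Real.exp (-‖z‖ ^ 2 / (2 * t)))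
        / (Real.pi ^ ((d : ℝ) / 2) * (2 * t) ^ ((d : ℝ) / 2))
      ≤ η / 10 := by
  obtain ⟨hη0, hη1⟩ := hη
  set L := Real.log (10 / η) with hL
  have hL0 : 0 ≤ L := Real.log_nonneg (by rw [le_div_iff₀ hη0]; linarith)
  have hexpL : rexp (-L) = η / 10 := by
    rw [Real.exp_neg, Real.exp_log (by positivity), inv_div]
  set b : ℝ := (2 * t)⁻¹ with hb_def
  have hb : 0 < b := by positivity
  have hfun : (fun z : EuclideanSpace ℝ (Fin d) => rexp (-‖z‖ ^ 2 / (2 * t)))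
      = fun z => rexp (-b * ‖z‖ ^ 2) := by
    funext z
    rw [hb_def]
    congr 1
    ring
  have hradius : d / 2 + L ≤ b / 2 * (t ^ γ) ^ 2 := by
    have hpow : (t ^ (γ - 1 / 2)) ^ 2 = (t ^ γ) ^ 2 / t := by
      rw [Real.rpow_sub ht, div_pow, ← Real.sqrt_eq_rpow, Real.sq_sqrt ht.le]
    have hsq : (√d + √(2 * L)) ^ 2 ≤ (t ^ (γ - 1 / 2) / √2) ^ 2 := by gcongr
    rw [div_pow, hpow, Real.sq_sqrt (by norm_num)] at hsq
    have hd2 : √(d : ℝ) ^ 2 = d := Real.sq_sqrt (by positivity)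
    have hL2 : √(2 * L) ^ 2 = 2 * L := Real.sq_sqrt (by positivity)
    have hcross : 0 ≤ √(d : ℝ) * √(2 * L) := by positivity
    have heq : b / 2 * (t ^ γ) ^ 2 = (t ^ γ) ^ 2 / t / 2 / 2 := by
      rw [hb_def]
      field_simp
    rw [heq]
    nlinarith
  have htotal := GaussianFourier.integral_rexp_neg_mul_sq_norm
    (V := EuclideanSpace ℝ (Fin d)) hb
  have htail := setIntegral_compl_closedBall_rexp_neg_mul_sq_norm_le
    (V := EuclideanSpace ℝ (Fin d)) hb (Real.rpow_nonneg ht.le γ)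
  have hsplit := integral_add_compl
    (Metric.isClosed_closedBall (x := (0 : EuclideanSpace ℝ (Fin d))) (ε := t ^ γ)).measurableSet
    (integrable_rexp_neg_mul_sq_norm (V := EuclideanSpace ℝ (Fin d)) hb)
  rw [finrank_euclideanSpace_fin] at htotal htail
  have hdiv : π / (b / 2) = 2 * (π / b) := by field_simp
  rw [hdiv, Real.mul_rpow (by norm_num) (by positivity)] at htail
  have hnorm : π ^ ((d : ℝ) / 2) * (2 * t) ^ ((d : ℝ) / 2) = (π / b) ^ ((d : ℝ) / 2) := by
    rw [← Real.mul_rpow (by positivity) (by positivity), hb_def, div_inv_eq_mul]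
  have hfactor : rexp (-(b / 2) * (t ^ γ) ^ 2) * 2 ^ ((d : ℝ) / 2) ≤ η / 10 := by
    calc rexp (-(b / 2) * (t ^ γ) ^ 2) * 2 ^ ((d : ℝ) / 2)
        ≤ rexp (-(b / 2) * (t ^ γ) ^ 2) * rexp ((d : ℝ) / 2) := by
          gcongr
          exact two_rpow_le_exp (by positivity)
      _ ≤ rexp (-L) := by
          rw [← Real.exp_add, Real.exp_le_exp]
          linarith
      _ = η / 10 := hexpL
  rw [hnorm, hfun]
  have hZ : 0 < (π / b) ^ ((d : ℝ) / 2) := by positivity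
  rw [one_sub_div hZ.ne', div_le_iff₀ hZ]
  have hscaled := mul_le_mul_of_nonneg_right hfactor hZ.le
  linarith
end

section
/- Let ε > 0, c ∈ (0,1), and η = c(2^{ε/2}−1)/(1+2^{ε/2}), and assume η < 1/2. If the multiplicative moment bounds with tolerance η hold on H = {t, t/2, 2t, 2t/3}, then E[W⁺] ≤ (1−c)(1−2^{ε/2}) P_t, and in particular E[W⁺] < 0. -/
open MeasureTheory ProbabilityTheory Real

/-- Properties of `W⁺`: expectation bound.
Let `ε > 0`, `c ∈ (0,1)`, and `η = c(2^{ε/2}−1)/(1+2^{ε/2})`, with `η < 1/2`. If the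
multiplicative moment bounds with tolerance `η` hold on `H = {t, t/2, 2t, 2t/3}`, then
`E[W⁺] ≤ (1−c)(1−2^{ε/2}) P_t`, and in particular `E[W⁺] < 0`, where
`W⁺ = K_{2t}(x,X) − 2^{(d+ε)/2} K_t(x,X)` and `P_t = 2^{d/2} p₀ π^{d/2} t^{d/2}`. -/
theorem Wplus_expectation_bound
    {N d : ℕ} (hN : 0 < N) (hd : 0 < d)
    {Ω : Type*} [MeasureSpace Ω] [IsProbabilityMeasure (ℙ : Measure Ω)]
    (X : Ω → EuclideanSpace ℝ (Fin N)) (x : EuclideanSpace ℝ (Fin N))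
    (t p₀ ε c η : ℝ) (ht : 0 < t) (hp₀ : 0 < p₀) (hε : 0 < ε)
    (hc : c ∈ Set.Ioo (0 : ℝ) 1)
    (hη : η = c * ((2 : ℝ) ^ (ε / 2) - 1) / (1 + (2 : ℝ) ^ (ε / 2)))
    (hη2 : η < 1 / 2)
    (hmom : ∀ s ∈ ({t, t / 2, 2 * t, 2 * t / 3} : Set ℝ),
      (1 - η) * p₀ * Real.pi ^ ((d : ℝ) / 2) * s ^ ((d : ℝ) / 2)
          ≤ ∫ ω, Real.exp (-‖x - X ω‖ ^ 2 / s) ∧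
        ∫ ω, Real.exp (-‖x - X ω‖ ^ 2 / s)
          ≤ (1 + η) * p₀ * Real.pi ^ ((d : ℝ) / 2) * s ^ ((d : ℝ) / 2)) :
    (∫ ω, (Real.exp (-‖x - X ω‖ ^ 2 / (2 * t))
          - (2 : ℝ) ^ (((d : ℝ) + ε) / 2) * Real.exp (-‖x - X ω‖ ^ 2 / t)))
        ≤ (1 - c) * (1 - (2 : ℝ) ^ (ε / 2)) *
          ((2 : ℝ) ^ ((d : ℝ) / 2) * p₀ * Real.pi ^ ((d : ℝ) / 2) * t ^ ((d : ℝ) / 2)) ∧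
      (∫ ω, (Real.exp (-‖x - X ω‖ ^ 2 / (2 * t))
          - (2 : ℝ) ^ (((d : ℝ) + ε) / 2) * Real.exp (-‖x - X ω‖ ^ 2 / t))) < 0 := by
  have he : (1 : ℝ) < (2 : ℝ) ^ (ε / 2) := Real.one_lt_rpow (by norm_num) (by linarith)
  have hsplit : (2 : ℝ) ^ (((d : ℝ) + ε) / 2) = (2 : ℝ) ^ ((d : ℝ) / 2) * (2 : ℝ) ^ (ε / 2) := by
    rw [← Real.rpow_add (by norm_num), add_div]
  have hlow : ∀ s : ℝ, 0 < s → 0 < (1 - η) * p₀ * Real.pi ^ ((d : ℝ) / 2) * s ^ ((d : ℝ) / 2) := by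
    intro s hs
    have h1 : 0 < 1 - η := by linarith
    have := Real.pi_pos
    positivity
  obtain ⟨hl, -⟩ := hmom t (by simp)
  obtain ⟨hl', hu'⟩ := hmom (2 * t) (by simp)
  -- A nonzero Bochner integral forces integrability, so measurability of `X` is not needed.
  have hint : Integrable (fun ω => Real.exp (-‖x - X ω‖ ^ 2 / t)) :=
    .of_integral_ne_zero ((hlow t ht).trans_le hl).ne'
  have hint' : Integrable (fun ω => Real.exp (-‖x - X ω‖ ^ 2 / (2 * t))) :=
    .of_integral_ne_zero ((hlow (2 * t) (by positivity)).trans_le hl').ne'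
  rw [Real.mul_rpow (by norm_num) ht.le] at hu'
  rw [integral_sub hint' (hint.const_mul _), integral_const_mul, hsplit]
  have hD : 0 < (2 : ℝ) ^ ((d : ℝ) / 2) := by positivity
  have hP : 0 < p₀ * Real.pi ^ ((d : ℝ) / 2) * t ^ ((d : ℝ) / 2) := by
    have := Real.pi_pos
    positivity
  have hη' : η * (1 + (2 : ℝ) ^ (ε / 2)) = c * ((2 : ℝ) ^ (ε / 2) - 1) := by
    rw [hη]
    field_simp
  generalize (2 : ℝ) ^ (ε / 2) = e at *
  generalize (2 : ℝ) ^ ((d : ℝ) / 2) = D at *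
  have hbound := mul_le_mul_of_nonneg_left hl (by positivity : 0 ≤ D * e)
  have hkey : (1 + η) * p₀ * Real.pi ^ ((d : ℝ) / 2) * (D * t ^ ((d : ℝ) / 2))
      - D * e * ((1 - η) * p₀ * Real.pi ^ ((d : ℝ) / 2) * t ^ ((d : ℝ) / 2))
      = (1 - c) * (1 - e) * (D * p₀ * Real.pi ^ ((d : ℝ) / 2) * t ^ ((d : ℝ) / 2)) := by
    linear_combination (D * p₀ * Real.pi ^ ((d : ℝ) / 2) * t ^ ((d : ℝ) / 2)) * hη'
  have hneg : (1 - c) * (1 - e) * (D * p₀ * Real.pi ^ ((d : ℝ) / 2) * t ^ ((d : ℝ) / 2)) < 0 := by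
    have hDP : 0 < D * p₀ * Real.pi ^ ((d : ℝ) / 2) * t ^ ((d : ℝ) / 2) := by
      simpa only [mul_assoc] using mul_pos hD hP
    exact mul_neg_of_neg_of_pos
      (mul_neg_of_pos_of_neg (by linarith [hc.2]) (by linarith)) hDP
  constructor <;> linarith
end

section
/- Let ε > 0, c ∈ (0,1), and η = c(2^{ε/2}−1)/(1+2^{ε/2}), and assume η < 1/2. If the multiplicative moment bounds with tolerance η hold on H = {t, t/2, 2t, 2t/3}, then E[W⁻] ≥ (1−c)(1−2^{−ε/2}) P_t, and in particular E[W⁻] > 0. -/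
open MeasureTheory ProbabilityTheory Real

/-- Properties of `W⁻`: expectation bound.
Let `ε > 0`, `c ∈ (0,1)`, and `η = c(2^{ε/2}−1)/(1+2^{ε/2})`, with `η < 1/2`. If the
multiplicative moment bounds with tolerance `η` hold on `H = {t, t/2, 2t, 2t/3}`, then
`E[W⁻] ≥ (1−c)(1−2^{−ε/2}) P_t`, and in particular `E[W⁻] > 0`, where
`W⁻ = K_{2t}(x,X) − 2^{(d−ε)/2} K_t(x,X)` and `P_t = 2^{d/2} p₀ π^{d/2} t^{d/2}`. -/
theorem Wminus_expectation_bound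
    {N d : ℕ} (hN : 0 < N) (hd : 0 < d)
    {Ω : Type*} [MeasureSpace Ω] [IsProbabilityMeasure (ℙ : Measure Ω)]
    (X : Ω → EuclideanSpace ℝ (Fin N)) (x : EuclideanSpace ℝ (Fin N))
    (t p₀ ε c η : ℝ) (ht : 0 < t) (hp₀ : 0 < p₀) (hε : 0 < ε)
    (hc : c ∈ Set.Ioo (0 : ℝ) 1)
    (hη : η = c * ((2 : ℝ) ^ (ε / 2) - 1) / (1 + (2 : ℝ) ^ (ε / 2)))
    (hη2 : η < 1 / 2)
    (hmom : ∀ s ∈ ({t, t / 2, 2 * t, 2 * t / 3} : Set ℝ),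
      (1 - η) * p₀ * Real.pi ^ ((d : ℝ) / 2) * s ^ ((d : ℝ) / 2)
          ≤ ∫ ω, Real.exp (-‖x - X ω‖ ^ 2 / s) ∧
        ∫ ω, Real.exp (-‖x - X ω‖ ^ 2 / s)
          ≤ (1 + η) * p₀ * Real.pi ^ ((d : ℝ) / 2) * s ^ ((d : ℝ) / 2)) :
    (1 - c) * (1 - (2 : ℝ) ^ (-ε / 2)) *
          ((2 : ℝ) ^ ((d : ℝ) / 2) * p₀ * Real.pi ^ ((d : ℝ) / 2) * t ^ ((d : ℝ) / 2))
        ≤ (∫ ω, (Real.exp (-‖x - X ω‖ ^ 2 / (2 * t))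
          - (2 : ℝ) ^ (((d : ℝ) - ε) / 2) * Real.exp (-‖x - X ω‖ ^ 2 / t))) ∧
      0 < (∫ ω, (Real.exp (-‖x - X ω‖ ^ 2 / (2 * t))
          - (2 : ℝ) ^ (((d : ℝ) - ε) / 2) * Real.exp (-‖x - X ω‖ ^ 2 / t))) := by
  have h_int : ∀ s ∈ ({t, t / 2, 2 * t, 2 * t / 3} : Set ℝ), 0 < s →
      Integrable (fun ω => Real.exp (-‖x - X ω‖ ^ 2 / s)) := by
    intro s hs hs0
    -- A non-integrable kernel would have Bochner integral zero.
    refine Integrable.of_integral_ne_zero (ne_of_gt (lt_of_lt_of_le ?_ (hmom s hs).1))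
    have : 0 < 1 - η := by linarith
    positivity
  have h_mem : t ∈ ({t, t / 2, 2 * t, 2 * t / 3} : Set ℝ) := by simp
  have h_mem2 : 2 * t ∈ ({t, t / 2, 2 * t, 2 * t / 3} : Set ℝ) := by simp
  obtain ⟨hc0, hc1⟩ := hc
  have ha : 1 < (2 : ℝ) ^ (ε / 2) := Real.one_lt_rpow (by norm_num) (by positivity)
  have h_neg : (2 : ℝ) ^ (-ε / 2) = ((2 : ℝ) ^ (ε / 2))⁻¹ := by
    rw [neg_div, Real.rpow_neg (by norm_num)]
  have h_sub : (2 : ℝ) ^ (((d : ℝ) - ε) / 2)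
      = (2 : ℝ) ^ ((d : ℝ) / 2) * ((2 : ℝ) ^ (ε / 2))⁻¹ := by
    rw [sub_div, Real.rpow_sub (by norm_num), div_eq_mul_inv]
  have h_lower := (hmom _ h_mem2).1
  have h_upper := (hmom _ h_mem).2
  rw [integral_sub (h_int _ h_mem2 (by positivity)) ((h_int _ h_mem ht).const_mul _),
    integral_const_mul, h_neg, h_sub]
  rw [Real.mul_rpow (by norm_num) ht.le] at h_lower
  set a := (2 : ℝ) ^ (ε / 2)
  set D := (2 : ℝ) ^ ((d : ℝ) / 2)
  set Q := Real.pi ^ ((d : ℝ) / 2)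
  set T := t ^ ((d : ℝ) / 2)
  have hD : 0 < D := by positivity
  have hQ : 0 < Q := by positivity
  have hT : 0 < T := by positivity
  have h_scaled := mul_le_mul_of_nonneg_left h_upper (show 0 ≤ D * a⁻¹ by positivity)
  have h_coeff : (1 - c) * (1 - a⁻¹) = (1 - η) - a⁻¹ * (1 + η) := by
    rw [hη]
    field_simp
    ring
  have h_pos : 0 < (1 - c) * (1 - a⁻¹) * (D * p₀ * Q * T) := by
    have h1 : 0 < 1 - c := by linarith
    have h2 : 0 < 1 - a⁻¹ := sub_pos.2 (inv_lt_one_of_one_lt₀ ha)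
    positivity
  have h_bound : (1 - c) * (1 - a⁻¹) * (D * p₀ * Q * T)
      = (1 - η) * p₀ * Q * (D * T) - D * a⁻¹ * ((1 + η) * p₀ * Q * T) := by
    rw [h_coeff]
    ring
  exact ⟨by linarith, by linarith⟩
end

section
/- Let ε > 0 and η ∈ (0, 1/2). If the multiplicative moment bounds with tolerance η hold on H = {t, t/2, 2t, 2t/3}, then Var(W⁺) ≤ 2^{ε+3} P_t. -/
open MeasureTheory ProbabilityTheory Real

/-- For nonnegative `f`, `g` and `c`, the variance of `f - c * g` is at most `E[f²] + c² E[g²]`. -/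
theorem variance_sub_const_mul_le {Ω : Type*} [MeasurableSpace Ω] {μ : Measure Ω}
    [IsProbabilityMeasure μ] {f g : Ω → ℝ} {c : ℝ} (hf : AEStronglyMeasurable f μ)
    (hg : AEStronglyMeasurable g μ) (hf0 : ∀ ω, 0 ≤ f ω) (hg0 : ∀ ω, 0 ≤ g ω) (hc : 0 ≤ c)
    (hf2 : Integrable (fun ω => f ω ^ 2) μ) (hg2 : Integrable (fun ω => g ω ^ 2) μ) :
    variance (fun ω => f ω - c * g ω) μ ≤ ∫ ω, f ω ^ 2 ∂μ + c ^ 2 * ∫ ω, g ω ^ 2 ∂μ := by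
  refine (variance_le_expectation_sq (hf.sub (hg.const_mul c))).trans ?_
  rw [← integral_const_mul, ← integral_add hf2 (hg2.const_mul _)]
  refine integral_mono_of_nonneg (.of_forall fun ω => sq_nonneg _)
    (hf2.add (hg2.const_mul _)) (.of_forall fun ω => ?_)
  have := mul_nonneg (hf0 ω) (mul_nonneg hc (hg0 ω))
  simp only [Pi.pow_apply, Pi.sub_apply]
  nlinarith

/-- Properties of `W⁺`: variance bound.
Let `ε > 0` and `η ∈ (0, 1/2)`. If the multiplicative moment bounds with tolerance
`η` hold on `H = {t, t/2, 2t, 2t/3}`, then `Var(W⁺) ≤ 2^{ε+3} P_t`, where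
`W⁺ = K_{2t}(x,X) − 2^{(d+ε)/2} K_t(x,X)` and `P_t = 2^{d/2} p₀ π^{d/2} t^{d/2}`. -/
theorem Wplus_variance_bound
    {N d : ℕ} (hN : 0 < N) (hd : 0 < d)
    {Ω : Type*} [MeasureSpace Ω] [IsProbabilityMeasure (ℙ : Measure Ω)]
    (X : Ω → EuclideanSpace ℝ (Fin N)) (x : EuclideanSpace ℝ (Fin N))
    (t p₀ ε η : ℝ) (ht : 0 < t) (hp₀ : 0 < p₀) (hε : 0 < ε)
    (hη : η ∈ Set.Ioo (0 : ℝ) (1 / 2))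
    (hmom : ∀ s ∈ ({t, t / 2, 2 * t, 2 * t / 3} : Set ℝ),
      (1 - η) * p₀ * Real.pi ^ ((d : ℝ) / 2) * s ^ ((d : ℝ) / 2)
          ≤ ∫ ω, Real.exp (-‖x - X ω‖ ^ 2 / s) ∧
        ∫ ω, Real.exp (-‖x - X ω‖ ^ 2 / s)
          ≤ (1 + η) * p₀ * Real.pi ^ ((d : ℝ) / 2) * s ^ ((d : ℝ) / 2)) :
    variance (fun ω => Real.exp (-‖x - X ω‖ ^ 2 / (2 * t))
        - (2 : ℝ) ^ (((d : ℝ) + ε) / 2) * Real.exp (-‖x - X ω‖ ^ 2 / t)) ℙ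
      ≤ (2 : ℝ) ^ (ε + 3) *
        ((2 : ℝ) ^ ((d : ℝ) / 2) * p₀ * Real.pi ^ ((d : ℝ) / 2) * t ^ ((d : ℝ) / 2)) := by
  have hη1 : η < 1 / 2 := hη.2
  have hint : ∀ s ∈ ({t, t / 2, 2 * t, 2 * t / 3} : Set ℝ), 0 < s →
      Integrable (fun ω => Real.exp (-‖x - X ω‖ ^ 2 / s)) ℙ := by
    intro s hs hs0
    refine .of_integral_ne_zero (ne_of_gt (lt_of_lt_of_le ?_ (hmom s hs).1))
    have : 0 < 1 - η := by linarith
    positivity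
  have hsq : ∀ (s : ℝ) (ω : Ω), Real.exp (-‖x - X ω‖ ^ 2 / s) ^ 2
      = Real.exp (-‖x - X ω‖ ^ 2 / (s / 2)) := by
    intro s ω
    rw [← Real.exp_nat_mul, div_div_eq_mul_div]
    push_cast
    ring_nf
  have h2t : 2 * t / 2 = t := by ring
  have hvar := variance_sub_const_mul_le (c := (2 : ℝ) ^ (((d : ℝ) + ε) / 2))
    (hint (2 * t) (by simp) (by positivity)).aestronglyMeasurable
    (hint t (by simp) ht).aestronglyMeasurable
    (fun ω => (Real.exp_pos _).le) (fun ω => (Real.exp_pos _).le) (by positivity)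
    (by simpa only [hsq, h2t] using hint t (by simp) ht)
    (by simpa only [hsq] using hint (t / 2) (by simp) (by positivity))
  simp only [hsq, h2t] at hvar
  have hK := (hmom t (by simp)).2
  have hK' := (hmom (t / 2) (by simp)).2
  rw [Real.div_rpow ht.le zero_le_two] at hK'
  have hcoef : ((2 : ℝ) ^ (((d : ℝ) + ε) / 2)) ^ 2
      = (2 : ℝ) ^ ε * (2 : ℝ) ^ ((d : ℝ) / 2) * (2 : ℝ) ^ ((d : ℝ) / 2) := by
    rw [← Real.rpow_natCast, ← Real.rpow_mul zero_le_two, ← Real.rpow_add two_pos,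
      ← Real.rpow_add two_pos]
    push_cast
    ring_nf
  have height : (2 : ℝ) ^ (ε + 3) = 2 ^ ε * 8 := by
    rw [Real.rpow_add two_pos]
    norm_num
  have hE : 1 ≤ (2 : ℝ) ^ ε := Real.one_le_rpow one_le_two hε.le
  have hD : 1 ≤ (2 : ℝ) ^ ((d : ℝ) / 2) := Real.one_le_rpow one_le_two (by positivity)
  have hA : 0 < p₀ * Real.pi ^ ((d : ℝ) / 2) * t ^ ((d : ℝ) / 2) := by positivity
  refine hvar.trans ((add_le_add hK (mul_le_mul_of_nonneg_left hK' (sq_nonneg _))).trans ?_)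
  rw [hcoef, height]
  generalize (2 : ℝ) ^ ε = E at *
  generalize (2 : ℝ) ^ ((d : ℝ) / 2) = D at *
  have hD0 : D ≠ 0 := by positivity
  have hED : 1 ≤ E * D := one_le_mul_of_one_le_of_one_le hE hD
  calc _ = ((1 + η) * (1 + E * D)) * (p₀ * Real.pi ^ ((d : ℝ) / 2) * t ^ ((d : ℝ) / 2)) := by
        field_simp
    _ ≤ (8 * (E * D)) * (p₀ * Real.pi ^ ((d : ℝ) / 2) * t ^ ((d : ℝ) / 2)) :=
        mul_le_mul_of_nonneg_right (by nlinarith) hA.le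
    _ = _ := by ring
end

section
/- Let ε > 0, c ∈ (0,1), and η = c(2^{ε/2}−1)/(1+2^{ε/2}) with η < 1/2. If the multiplicative moment bounds with tolerance η hold on H = {t, 2t}, then E[Y₊] ≤ (2^{ε/2}−1)(1+c) P_t and E[−Y₋] ≤ (1−2^{−ε/2})(1+c) P_t. -/
open MeasureTheory ProbabilityTheory Real

/-- First moment bounds in the anti-concentration lemma.
Let `ε > 0`, `c ∈ (0,1)`, `η = c(2^{ε/2}−1)/(1+2^{ε/2})` with `η < 1/2`. If the
multiplicative moment bounds with tolerance `η` hold on `H = {t, 2t}`, then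
`E[Y₊] ≤ (2^{ε/2}−1)(1+c) P_t` and `E[−Y₋] ≤ (1−2^{−ε/2})(1+c) P_t`, where
`Y± = 2^{(d±ε)/2} K_t(x,X) − K_{2t}(x,X)` and `P_t = 2^{d/2} p₀ π^{d/2} t^{d/2}`. -/
theorem Y_expectation_bounds
    {N d : ℕ} (hN : 0 < N) (hd : 0 < d)
    {Ω : Type*} [MeasureSpace Ω] [IsProbabilityMeasure (ℙ : Measure Ω)]
    (X : Ω → EuclideanSpace ℝ (Fin N)) (x : EuclideanSpace ℝ (Fin N))
    (t p₀ ε c η : ℝ) (ht : 0 < t) (hp₀ : 0 < p₀) (hε : 0 < ε)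
    (hc : c ∈ Set.Ioo (0 : ℝ) 1)
    (hη : η = c * ((2 : ℝ) ^ (ε / 2) - 1) / (1 + (2 : ℝ) ^ (ε / 2)))
    (hη2 : η < 1 / 2)
    (hmom : ∀ s ∈ ({t, 2 * t} : Set ℝ),
      (1 - η) * p₀ * Real.pi ^ ((d : ℝ) / 2) * s ^ ((d : ℝ) / 2)
          ≤ ∫ ω, Real.exp (-‖x - X ω‖ ^ 2 / s) ∧
        ∫ ω, Real.exp (-‖x - X ω‖ ^ 2 / s)
          ≤ (1 + η) * p₀ * Real.pi ^ ((d : ℝ) / 2) * s ^ ((d : ℝ) / 2)) :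
    (∫ ω, ((2 : ℝ) ^ (((d : ℝ) + ε) / 2) * Real.exp (-‖x - X ω‖ ^ 2 / t)
          - Real.exp (-‖x - X ω‖ ^ 2 / (2 * t))))
        ≤ ((2 : ℝ) ^ (ε / 2) - 1) * (1 + c) *
          ((2 : ℝ) ^ ((d : ℝ) / 2) * p₀ * Real.pi ^ ((d : ℝ) / 2) * t ^ ((d : ℝ) / 2)) ∧
      (∫ ω, -((2 : ℝ) ^ (((d : ℝ) - ε) / 2) * Real.exp (-‖x - X ω‖ ^ 2 / t)
          - Real.exp (-‖x - X ω‖ ^ 2 / (2 * t))))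
        ≤ (1 - (2 : ℝ) ^ (-ε / 2)) * (1 + c) *
          ((2 : ℝ) ^ ((d : ℝ) / 2) * p₀ * Real.pi ^ ((d : ℝ) / 2) * t ^ ((d : ℝ) / 2)) := by
  obtain ⟨hl₁, hu₁⟩ := hmom t (by simp)
  obtain ⟨hl₂, hu₂⟩ := hmom (2 * t) (by simp)
  have hη_pos : 0 < 1 - η := by linarith
  have hint₁ : Integrable (fun ω => Real.exp (-‖x - X ω‖ ^ 2 / t)) := by
    refine Integrable.of_integral_ne_zero (lt_of_lt_of_le ?_ hl₁).ne'
    positivity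
  have hint₂ : Integrable (fun ω => Real.exp (-‖x - X ω‖ ^ 2 / (2 * t))) := by
    refine Integrable.of_integral_ne_zero (lt_of_lt_of_le ?_ hl₂).ne'
    positivity
  have ha : (0 : ℝ) < 2 ^ (ε / 2) := by positivity
  have hadd : (2 : ℝ) ^ (((d : ℝ) + ε) / 2) = 2 ^ ((d : ℝ) / 2) * 2 ^ (ε / 2) := by
    rw [← Real.rpow_add two_pos]
    ring_nf
  have hneg : (2 : ℝ) ^ (-ε / 2) = (2 ^ (ε / 2))⁻¹ := by
    rw [neg_div, Real.rpow_neg two_pos.le]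
  have hsub : (2 : ℝ) ^ (((d : ℝ) - ε) / 2) = 2 ^ ((d : ℝ) / 2) * (2 ^ (ε / 2))⁻¹ := by
    rw [← Real.rpow_neg two_pos.le, ← Real.rpow_add two_pos]
    ring_nf
  have hηa : η * (1 + (2 : ℝ) ^ (ε / 2)) = c * ((2 : ℝ) ^ (ε / 2) - 1) := by
    rw [hη]
    field_simp
  have hηa_inv : η * (1 + ((2 : ℝ) ^ (ε / 2))⁻¹) = c * (1 - ((2 : ℝ) ^ (ε / 2))⁻¹) := by
    field_simp
    linarith
  have hD : (0 : ℝ) < 2 ^ ((d : ℝ) / 2) := by positivity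
  rw [Real.mul_rpow two_pos.le ht.le] at hl₂ hu₂
  rw [integral_neg, integral_sub (hint₁.const_mul _) hint₂,
    integral_sub (hint₁.const_mul _) hint₂, integral_const_mul, integral_const_mul,
    hadd, hsub, hneg]
  generalize (2 : ℝ) ^ (ε / 2) = a at *
  generalize (2 : ℝ) ^ ((d : ℝ) / 2) = D at *
  generalize Real.pi ^ ((d : ℝ) / 2) = q at *
  generalize t ^ ((d : ℝ) / 2) = r at *
  constructor
  · have h := mul_le_mul_of_nonneg_left hu₁ (mul_pos hD ha).le
    linear_combination h + hl₂ + D * p₀ * q * r * hηa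
  · have h := mul_le_mul_of_nonneg_left hl₁ (mul_pos hD (inv_pos.mpr ha)).le
    linear_combination h + hu₂ + D * p₀ * q * r * hηa_inv
end

section
/- Let ε > 0, c ∈ (0,1), and η = c(2^{ε/2}−1)/(1+2^{ε/2}) with η < 1/2. Define Γ₊ = 1 − 2^{1−ε/2}(2/3)^{d/2} + 2^{−d/2−ε} and η*₊ = η(1 + 2^{1−ε/2}(2/3)^{d/2} + 2^{−d/2−ε})/Γ₊, and assume Γ₊ > 0 and η*₊ < 1. If the multiplicative moment bounds with tolerance η hold on H = {t, t/2, 2t/3, 2t}, then E[Y₊²] ≥ 2^{ε} Γ₊ (1−η*₊) P_t, and consequently Var(Y₊) ≥ 2^{ε} Γ₊ (1−η*₊) P_t − (2^{ε/2}−1)²(1+c)² P_t². -/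
open MeasureTheory ProbabilityTheory Real

/-- The product identity `K_a K_b = K_s` with `1 / s = 1 / a + 1 / b`, in exponential form. -/
lemma exp_neg_div_mul_exp_neg_div {a b s : ℝ} (q : ℝ) (hs : 1 / a + 1 / b = 1 / s) :
    Real.exp (-q / a) * Real.exp (-q / b) = Real.exp (-q / s) := by
  rw [← Real.exp_add]
  congr 1
  linear_combination (-q) * hs

/-- Second moment of a linear combination of two kernels whose pairwise products are
integrable kernels, and the resulting value of the variance. -/
lemma moments_mul_sub {Ω : Type*} [MeasureSpace Ω] [IsProbabilityMeasure (ℙ : Measure Ω)]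
    {f g ff fg gg : Ω → ℝ} (A : ℝ) (hf : Integrable f) (hg : Integrable g)
    (hff : Integrable ff) (hfg : Integrable fg) (hgg : Integrable gg)
    (eff : ∀ ω, f ω * f ω = ff ω) (efg : ∀ ω, f ω * g ω = fg ω)
    (egg : ∀ ω, g ω * g ω = gg ω) :
    (∫ ω, (A * f ω - g ω) ^ 2) = A ^ 2 * (∫ ω, ff ω) - 2 * A * (∫ ω, fg ω) + ∫ ω, gg ω ∧
      variance (fun ω => A * f ω - g ω) ℙ =
        (∫ ω, (A * f ω - g ω) ^ 2) - (A * (∫ ω, f ω) - ∫ ω, g ω) ^ 2 := by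
  have hsq : (fun ω => (A * f ω - g ω) ^ 2) =
      fun ω => A ^ 2 * ff ω - 2 * A * fg ω + gg ω := by
    funext ω
    rw [← eff, ← efg, ← egg]
    ring
  have hsub : Integrable (fun ω => A ^ 2 * ff ω - 2 * A * fg ω) :=
    (hff.const_mul _).sub (hfg.const_mul _)
  have hint : Integrable (fun ω => (A * f ω - g ω) ^ 2) := by
    rw [hsq]
    exact hsub.add hgg
  have hY : Integrable (fun ω => A * f ω - g ω) := (hf.const_mul A).sub hg
  constructor
  · rw [hsq, integral_add hsub hgg,
      integral_sub (hff.const_mul _) (hfg.const_mul _), integral_const_mul, integral_const_mul]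
  · rw [variance_eq_sub ((memLp_two_iff_integrable_sq hY.aestronglyMeasurable).2 hint),
      integral_sub (hf.const_mul A) hg, integral_const_mul]
    rfl

/-- Second-moment and variance lower bounds for `Y₊`.
With `Γ₊ = 1 − 2^{1−ε/2}(2/3)^{d/2} + 2^{−d/2−ε} > 0` and
`η*₊ = η(1 + 2^{1−ε/2}(2/3)^{d/2} + 2^{−d/2−ε})/Γ₊ < 1`, if the multiplicative moment
bounds with tolerance `η` hold on `H = {t, t/2, 2t/3, 2t}`, then
`E[Y₊²] ≥ 2^ε Γ₊ (1−η*₊) P_t` and consequently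
`Var(Y₊) ≥ 2^ε Γ₊ (1−η*₊) P_t − (2^{ε/2}−1)²(1+c)² P_t²`. -/
theorem Yplus_variance_lower_bound
    {N d : ℕ} (hN : 0 < N) (hd : 0 < d)
    {Ω : Type*} [MeasureSpace Ω] [IsProbabilityMeasure (ℙ : Measure Ω)]
    (X : Ω → EuclideanSpace ℝ (Fin N)) (x : EuclideanSpace ℝ (Fin N))
    (t p₀ ε c η : ℝ) (ht : 0 < t) (hp₀ : 0 < p₀) (hε : 0 < ε)
    (hc : c ∈ Set.Ioo (0 : ℝ) 1)
    (hη : η = c * ((2 : ℝ) ^ (ε / 2) - 1) / (1 + (2 : ℝ) ^ (ε / 2)))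
    (hη2 : η < 1 / 2)
    (Γp ηstar : ℝ)
    (hΓp : Γp = 1 - (2 : ℝ) ^ (1 - ε / 2) * ((2 : ℝ) / 3) ^ ((d : ℝ) / 2)
      + (2 : ℝ) ^ (-(d : ℝ) / 2 - ε))
    (hΓppos : 0 < Γp)
    (hηstar : ηstar = η * (1 + (2 : ℝ) ^ (1 - ε / 2) * ((2 : ℝ) / 3) ^ ((d : ℝ) / 2)
      + (2 : ℝ) ^ (-(d : ℝ) / 2 - ε)) / Γp)
    (hηstar1 : ηstar < 1)
    (hmom : ∀ s ∈ ({t, t / 2, 2 * t / 3, 2 * t} : Set ℝ),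
      (1 - η) * p₀ * Real.pi ^ ((d : ℝ) / 2) * s ^ ((d : ℝ) / 2)
          ≤ ∫ ω, Real.exp (-‖x - X ω‖ ^ 2 / s) ∧
        ∫ ω, Real.exp (-‖x - X ω‖ ^ 2 / s)
          ≤ (1 + η) * p₀ * Real.pi ^ ((d : ℝ) / 2) * s ^ ((d : ℝ) / 2)) :
    (2 : ℝ) ^ ε * Γp * (1 - ηstar) *
        ((2 : ℝ) ^ ((d : ℝ) / 2) * p₀ * Real.pi ^ ((d : ℝ) / 2) * t ^ ((d : ℝ) / 2))
      ≤ (∫ ω, ((2 : ℝ) ^ (((d : ℝ) + ε) / 2) * Real.exp (-‖x - X ω‖ ^ 2 / t)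
            - Real.exp (-‖x - X ω‖ ^ 2 / (2 * t))) ^ 2) ∧
      (2 : ℝ) ^ ε * Γp * (1 - ηstar) *
          ((2 : ℝ) ^ ((d : ℝ) / 2) * p₀ * Real.pi ^ ((d : ℝ) / 2) * t ^ ((d : ℝ) / 2))
        - ((2 : ℝ) ^ (ε / 2) - 1) ^ 2 * (1 + c) ^ 2 *
          ((2 : ℝ) ^ ((d : ℝ) / 2) * p₀ * Real.pi ^ ((d : ℝ) / 2) * t ^ ((d : ℝ) / 2)) ^ 2
        ≤ variance (fun ω => (2 : ℝ) ^ (((d : ℝ) + ε) / 2) * Real.exp (-‖x - X ω‖ ^ 2 / t)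
            - Real.exp (-‖x - X ω‖ ^ 2 / (2 * t))) ℙ := by
  obtain ⟨hc0, hc1⟩ := hc
  have hint : ∀ s ∈ ({t, t / 2, 2 * t / 3, 2 * t} : Set ℝ),
      Integrable (fun ω => Real.exp (-‖x - X ω‖ ^ 2 / s)) := by
    intro s hs
    have hs0 : 0 < s := by
      rcases hs with rfl | rfl | rfl | rfl <;> positivity
    refine Integrable.of_integral_ne_zero (ne_of_gt (lt_of_lt_of_le ?_ (hmom s hs).1))
    have : 0 < 1 - η := by linarith
    positivity
  have ht1 : t ∈ ({t, t / 2, 2 * t / 3, 2 * t} : Set ℝ) := by simp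
  have ht2 : t / 2 ∈ ({t, t / 2, 2 * t / 3, 2 * t} : Set ℝ) := by simp
  have ht3 : 2 * t / 3 ∈ ({t, t / 2, 2 * t / 3, 2 * t} : Set ℝ) := by simp
  have ht4 : 2 * t ∈ ({t, t / 2, 2 * t / 3, 2 * t} : Set ℝ) := by simp
  obtain ⟨l1, u1⟩ := hmom _ ht1
  obtain ⟨l2, -⟩ := hmom _ ht2
  obtain ⟨-, u3⟩ := hmom _ ht3
  obtain ⟨l4, u4⟩ := hmom _ ht4
  obtain ⟨hsecond, hvar⟩ := moments_mul_sub ((2 : ℝ) ^ (((d : ℝ) + ε) / 2))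
    (hint _ ht1) (hint _ ht4) (hint _ ht2) (hint _ ht3) (hint _ ht1)
    (fun ω => exp_neg_div_mul_exp_neg_div (‖x - X ω‖ ^ 2) (by field_simp; norm_num))
    (fun ω => exp_neg_div_mul_exp_neg_div (‖x - X ω‖ ^ 2) (by field_simp; norm_num))
    (fun ω => exp_neg_div_mul_exp_neg_div (‖x - X ω‖ ^ 2) (by field_simp; norm_num))
  have hA : (2 : ℝ) ^ (((d : ℝ) + ε) / 2) = 2 ^ ((d : ℝ) / 2) * 2 ^ (ε / 2) := by
    rw [← Real.rpow_add two_pos]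
    ring_nf
  have hE : (2 : ℝ) ^ ε = (2 ^ (ε / 2)) ^ 2 := by
    rw [sq, ← Real.rpow_add two_pos]
    ring_nf
  have hB : (2 : ℝ) ^ (1 - ε / 2) = 2 / 2 ^ (ε / 2) := by
    rw [Real.rpow_sub two_pos, Real.rpow_one]
  have hG : (2 : ℝ) ^ (-(d : ℝ) / 2 - ε) = 1 / (2 ^ ((d : ℝ) / 2) * (2 ^ (ε / 2)) ^ 2) := by
    rw [Real.rpow_sub two_pos, neg_div, Real.rpow_neg two_pos.le, hE]
    field_simp
  have h2 : (t / 2) ^ ((d : ℝ) / 2) = t ^ ((d : ℝ) / 2) / 2 ^ ((d : ℝ) / 2) :=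
    Real.div_rpow ht.le two_pos.le _
  have h3 : (2 * t / 3) ^ ((d : ℝ) / 2) = (2 / 3 : ℝ) ^ ((d : ℝ) / 2) * t ^ ((d : ℝ) / 2) := by
    rw [← Real.mul_rpow (by norm_num) ht.le]
    ring_nf
  have h4 : (2 * t) ^ ((d : ℝ) / 2) = 2 ^ ((d : ℝ) / 2) * t ^ ((d : ℝ) / 2) :=
    Real.mul_rpow two_pos.le ht.le
  have ha1 : 1 < (2 : ℝ) ^ (ε / 2) := Real.one_lt_rpow one_lt_two (by positivity)
  rw [h2] at l2
  rw [h3] at u3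
  rw [h4] at l4 u4
  rw [hB, hG] at hΓp hηstar
  rw [hvar, hsecond, hA, hE]
  have hD : 0 < (2 : ℝ) ^ ((d : ℝ) / 2) := by positivity
  have hT : 0 < t ^ ((d : ℝ) / 2) := by positivity
  have hπ : 0 < Real.pi ^ ((d : ℝ) / 2) := by positivity
  generalize (2 : ℝ) ^ ((d : ℝ) / 2) = D at *
  generalize (2 : ℝ) ^ (ε / 2) = a at *
  generalize (2 / 3 : ℝ) ^ ((d : ℝ) / 2) = r at *
  generalize t ^ ((d : ℝ) / 2) = T at *
  generalize Real.pi ^ ((d : ℝ) / 2) = w at *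
  generalize (∫ ω, Real.exp (-‖x - X ω‖ ^ 2 / t)) = I1 at *
  generalize (∫ ω, Real.exp (-‖x - X ω‖ ^ 2 / (t / 2))) = I2 at *
  generalize (∫ ω, Real.exp (-‖x - X ω‖ ^ 2 / (2 * t / 3))) = I3 at *
  generalize (∫ ω, Real.exp (-‖x - X ω‖ ^ 2 / (2 * t))) = I4 at *
  have ha : 0 < a := by linarith
  have hηa : η * (1 + a) = c * (a - 1) := by
    rw [hη]
    field_simp
  have hΓη : Γp * (1 - ηstar) = (1 - η) - (1 + η) * (2 / a * r) + (1 - η) * (1 / (D * a ^ 2)) := by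
    have : Γp * ηstar = η * (1 + 2 / a * r + 1 / (D * a ^ 2)) := by
      rw [hηstar]
      field_simp
    linear_combination hΓp - this
  have hmain : a ^ 2 * Γp * (1 - ηstar) * (D * p₀ * w * T) ≤
      (D * a) ^ 2 * I2 - 2 * (D * a) * I3 + I1 := by
    have e : a ^ 2 * Γp * (1 - ηstar) * (D * p₀ * w * T) =
        (D * a) ^ 2 * ((1 - η) * p₀ * w * (T / D)) -
          2 * (D * a) * ((1 + η) * p₀ * w * (r * T)) + (1 - η) * p₀ * w * T := by
      rw [mul_assoc (a ^ 2), hΓη]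
      field_simp
    rw [e]
    gcongr
  have hmean : (D * a * I1 - I4) ^ 2 ≤ (a - 1) ^ 2 * (1 + c) ^ 2 * (D * p₀ * w * T) ^ 2 := by
    have hlow : (a - 1) * (1 - c) * (D * p₀ * w * T) ≤ D * a * I1 - I4 := by
      have := mul_le_mul_of_nonneg_left l1 (by positivity : 0 ≤ D * a)
      linear_combination this + u4 + (D * p₀ * w * T) * hηa
    have hupp : D * a * I1 - I4 ≤ (a - 1) * (1 + c) * (D * p₀ * w * T) := by
      have := mul_le_mul_of_nonneg_left u1 (by positivity : 0 ≤ D * a)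
      linear_combination this + l4 + (D * p₀ * w * T) * hηa
    have h0 : 0 ≤ (a - 1) * (1 - c) * (D * p₀ * w * T) :=
      mul_nonneg (mul_nonneg (by linarith) (by linarith)) (by positivity)
    rw [← mul_pow, ← mul_pow]
    exact pow_le_pow_left₀ (h0.trans hlow) hupp 2
  exact ⟨hmain, by linarith⟩
end

section
/- Let ε > 0, c ∈ (0,1), and η = c(2^{ε/2}−1)/(1+2^{ε/2}) with η < 1/2. Define Γ₋ = 1 − 2^{1+ε/2}(2/3)^{d/2} + 2^{−d/2+ε} and η*₋ = η(1 + 2^{1+ε/2}(2/3)^{d/2} + 2^{−d/2+ε})/Γ₋, and assume Γ₋ > 0 and η*₋ < 1. If the multiplicative moment bounds with tolerance η hold on H = {t, t/2, 2t/3, 2t}, then E[Y₋²] ≥ 2^{−ε} Γ₋ (1−η*₋) P_t, and consequently Var(Y₋) ≥ 2^{−ε} Γ₋ (1−η*₋) P_t − (1−2^{−ε/2})²(1+c)² P_t². -/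
open MeasureTheory ProbabilityTheory Real

/-- The square of a combination of Gaussian kernels at bandwidths `t` and `2t` is a combination
of kernels at bandwidths `t/2`, `2t/3` and `t`. -/
theorem sq_mul_exp_sub_exp_two_mul (a u : ℝ) {t : ℝ} (ht : t ≠ 0) :
    (a * exp (u / t) - exp (u / (2 * t))) ^ 2
      = a ^ 2 * exp (u / (t / 2)) - 2 * a * exp (u / (2 * t / 3)) + exp (u / t) := by
  have h₁ : exp (u / (t / 2)) = exp (u / t) * exp (u / t) := by
    rw [← exp_add]; congr 1; field_simp; ring
  have h₂ : exp (u / (2 * t / 3)) = exp (u / t) * exp (u / (2 * t)) := by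
    rw [← exp_add]; congr 1; field_simp; ring
  have h₃ : exp (u / t) = exp (u / (2 * t)) * exp (u / (2 * t)) := by
    rw [← exp_add]; congr 1; field_simp; ring
  rw [h₁, h₂]
  linear_combination h₃ * (-1 : ℝ)

/-- Second-moment and variance lower bounds for `Y₋`.
With `Γ₋ = 1 − 2^{1+ε/2}(2/3)^{d/2} + 2^{−d/2+ε} > 0` and
`η*₋ = η(1 + 2^{1+ε/2}(2/3)^{d/2} + 2^{−d/2+ε})/Γ₋ < 1`, if the multiplicative moment
bounds with tolerance `η` hold on `H = {t, t/2, 2t/3, 2t}`, then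
`E[Y₋²] ≥ 2^{−ε} Γ₋ (1−η*₋) P_t` and consequently
`Var(Y₋) ≥ 2^{−ε} Γ₋ (1−η*₋) P_t − (1−2^{−ε/2})²(1+c)² P_t²`. -/
theorem Yminus_variance_lower_bound
    {N d : ℕ} (hN : 0 < N) (hd : 0 < d)
    {Ω : Type*} [MeasureSpace Ω] [IsProbabilityMeasure (ℙ : Measure Ω)]
    (X : Ω → EuclideanSpace ℝ (Fin N)) (x : EuclideanSpace ℝ (Fin N))
    (t p₀ ε c η : ℝ) (ht : 0 < t) (hp₀ : 0 < p₀) (hε : 0 < ε)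
    (hc : c ∈ Set.Ioo (0 : ℝ) 1)
    (hη : η = c * ((2 : ℝ) ^ (ε / 2) - 1) / (1 + (2 : ℝ) ^ (ε / 2)))
    (hη2 : η < 1 / 2)
    (Γp ηstar : ℝ)
    (hΓp : Γp = 1 - (2 : ℝ) ^ (1 + ε / 2) * ((2 : ℝ) / 3) ^ ((d : ℝ) / 2)
      + (2 : ℝ) ^ (-(d : ℝ) / 2 + ε))
    (hΓppos : 0 < Γp)
    (hηstar : ηstar = η * (1 + (2 : ℝ) ^ (1 + ε / 2) * ((2 : ℝ) / 3) ^ ((d : ℝ) / 2)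
      + (2 : ℝ) ^ (-(d : ℝ) / 2 + ε)) / Γp)
    (hηstar1 : ηstar < 1)
    (hmom : ∀ s ∈ ({t, t / 2, 2 * t / 3, 2 * t} : Set ℝ),
      (1 - η) * p₀ * Real.pi ^ ((d : ℝ) / 2) * s ^ ((d : ℝ) / 2)
          ≤ ∫ ω, Real.exp (-‖x - X ω‖ ^ 2 / s) ∧
        ∫ ω, Real.exp (-‖x - X ω‖ ^ 2 / s)
          ≤ (1 + η) * p₀ * Real.pi ^ ((d : ℝ) / 2) * s ^ ((d : ℝ) / 2)) :
    (2 : ℝ) ^ (-ε) * Γp * (1 - ηstar) *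
        ((2 : ℝ) ^ ((d : ℝ) / 2) * p₀ * Real.pi ^ ((d : ℝ) / 2) * t ^ ((d : ℝ) / 2))
      ≤ (∫ ω, ((2 : ℝ) ^ (((d : ℝ) - ε) / 2) * Real.exp (-‖x - X ω‖ ^ 2 / t)
            - Real.exp (-‖x - X ω‖ ^ 2 / (2 * t))) ^ 2) ∧
      (2 : ℝ) ^ (-ε) * Γp * (1 - ηstar) *
          ((2 : ℝ) ^ ((d : ℝ) / 2) * p₀ * Real.pi ^ ((d : ℝ) / 2) * t ^ ((d : ℝ) / 2))
        - (1 - (2 : ℝ) ^ (-ε / 2)) ^ 2 * (1 + c) ^ 2 *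
          ((2 : ℝ) ^ ((d : ℝ) / 2) * p₀ * Real.pi ^ ((d : ℝ) / 2) * t ^ ((d : ℝ) / 2)) ^ 2
        ≤ variance (fun ω => (2 : ℝ) ^ (((d : ℝ) - ε) / 2) * Real.exp (-‖x - X ω‖ ^ 2 / t)
            - Real.exp (-‖x - X ω‖ ^ 2 / (2 * t))) ℙ := by
  have he1 : 1 < (2 : ℝ) ^ (ε / 2) := one_lt_rpow (by norm_num) (by positivity)
  have hA0 : 0 < (2 : ℝ) ^ ((d : ℝ) / 2) := by positivity
  have hT0 : 0 < t ^ ((d : ℝ) / 2) := by positivity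
  have hB0 : 0 < p₀ * Real.pi ^ ((d : ℝ) / 2) := by positivity
  have int_of_mem : ∀ s ∈ ({t, t / 2, 2 * t / 3, 2 * t} : Set ℝ),
      Integrable (fun ω => Real.exp (-‖x - X ω‖ ^ 2 / s)) (ℙ : Measure Ω) := by
    intro s hs
    have hs0 : 0 < s := by
      rcases hs with rfl | rfl | rfl | rfl <;> positivity
    have hlow : 0 < (1 - η) * p₀ * Real.pi ^ ((d : ℝ) / 2) * s ^ ((d : ℝ) / 2) := by
      have : 0 < 1 - η := by linarith
      positivity
    exact Integrable.of_integral_ne_zero (hlow.trans_le (hmom s hs).1).ne'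
  have I1 := int_of_mem t (by simp)
  have I2 := int_of_mem (t / 2) (by simp)
  have I3 := int_of_mem (2 * t / 3) (by simp)
  have I4 := int_of_mem (2 * t) (by simp)
  obtain ⟨l1, u1⟩ := hmom t (by simp)
  obtain ⟨l2, -⟩ := hmom (t / 2) (by simp)
  obtain ⟨-, u3⟩ := hmom (2 * t / 3) (by simp)
  obtain ⟨l4, u4⟩ := hmom (2 * t) (by simp)
  rw [div_rpow ht.le (by norm_num)] at l2
  rw [show 2 * t / 3 = 2 / 3 * t by ring, mul_rpow (by norm_num) ht.le,
    show 2 / 3 * t = 2 * t / 3 by ring] at u3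
  rw [mul_rpow (by norm_num) ht.le] at l4 u4
  have ha : (2 : ℝ) ^ (((d : ℝ) - ε) / 2) = (2 : ℝ) ^ ((d : ℝ) / 2) / (2 : ℝ) ^ (ε / 2) := by
    rw [sub_div, rpow_sub (by norm_num)]
  have hee : (2 : ℝ) ^ ε = ((2 : ℝ) ^ (ε / 2)) ^ 2 := by
    rw [← rpow_natCast, ← rpow_mul (by norm_num)]; congr 1; push_cast; ring
  have hen : (2 : ℝ) ^ (-ε) = (((2 : ℝ) ^ (ε / 2)) ^ 2)⁻¹ := by
    rw [rpow_neg (by norm_num), hee]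
  have hen2 : (2 : ℝ) ^ (-ε / 2) = ((2 : ℝ) ^ (ε / 2))⁻¹ := by
    rw [neg_div, rpow_neg (by norm_num)]
  have h1e : (2 : ℝ) ^ (1 + ε / 2) = 2 * (2 : ℝ) ^ (ε / 2) := by
    rw [rpow_add (by norm_num), rpow_one]
  have hdA : (2 : ℝ) ^ (-(d : ℝ) / 2 + ε)
      = ((2 : ℝ) ^ (ε / 2)) ^ 2 / (2 : ℝ) ^ ((d : ℝ) / 2) := by
    rw [rpow_add (by norm_num), neg_div, rpow_neg (by norm_num), hee]; ring
  have hsq := fun ω => sq_mul_exp_sub_exp_two_mul ((2 : ℝ) ^ (((d : ℝ) - ε) / 2))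
    (-‖x - X ω‖ ^ 2) ht.ne'
  have Isq : Integrable (fun ω => ((2 : ℝ) ^ (((d : ℝ) - ε) / 2) * Real.exp (-‖x - X ω‖ ^ 2 / t)
      - Real.exp (-‖x - X ω‖ ^ 2 / (2 * t))) ^ 2) (ℙ : Measure Ω) := by
    simp_rw [hsq]
    exact ((I2.const_mul _).sub (I3.const_mul _)).add I1
  have IY := (I1.const_mul ((2 : ℝ) ^ (((d : ℝ) - ε) / 2))).sub I4
  have Esq : ∫ ω, ((2 : ℝ) ^ (((d : ℝ) - ε) / 2) * Real.exp (-‖x - X ω‖ ^ 2 / t)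
      - Real.exp (-‖x - X ω‖ ^ 2 / (2 * t))) ^ 2
      = ((2 : ℝ) ^ (((d : ℝ) - ε) / 2)) ^ 2 * (∫ ω, Real.exp (-‖x - X ω‖ ^ 2 / (t / 2)))
        - 2 * (2 : ℝ) ^ (((d : ℝ) - ε) / 2) * (∫ ω, Real.exp (-‖x - X ω‖ ^ 2 / (2 * t / 3)))
        + ∫ ω, Real.exp (-‖x - X ω‖ ^ 2 / t) := by
    simp_rw [hsq]
    rw [integral_add, integral_sub, integral_const_mul, integral_const_mul]
    exacts [I2.const_mul _, I3.const_mul _, (I2.const_mul _).sub (I3.const_mul _), I1]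
  have EY : ∫ ω, ((2 : ℝ) ^ (((d : ℝ) - ε) / 2) * Real.exp (-‖x - X ω‖ ^ 2 / t)
      - Real.exp (-‖x - X ω‖ ^ 2 / (2 * t)))
      = (2 : ℝ) ^ (((d : ℝ) - ε) / 2) * (∫ ω, Real.exp (-‖x - X ω‖ ^ 2 / t))
        - ∫ ω, Real.exp (-‖x - X ω‖ ^ 2 / (2 * t)) := by
    rw [integral_sub (I1.const_mul _) I4, integral_const_mul]
  have hvar := variance_eq_sub ((memLp_two_iff_integrable_sq IY.aestronglyMeasurable).2 Isq)
  have hvar' : variance (fun ω => (2 : ℝ) ^ (((d : ℝ) - ε) / 2) * Real.exp (-‖x - X ω‖ ^ 2 / t)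
      - Real.exp (-‖x - X ω‖ ^ 2 / (2 * t))) ℙ
      = (∫ ω, ((2 : ℝ) ^ (((d : ℝ) - ε) / 2) * Real.exp (-‖x - X ω‖ ^ 2 / t)
          - Real.exp (-‖x - X ω‖ ^ 2 / (2 * t))) ^ 2)
        - (∫ ω, ((2 : ℝ) ^ (((d : ℝ) - ε) / 2) * Real.exp (-‖x - X ω‖ ^ 2 / t)
          - Real.exp (-‖x - X ω‖ ^ 2 / (2 * t)))) ^ 2 := hvar
  rw [hvar', Esq, EY, ha, hen, hen2]
  rw [h1e, hdA] at hΓp hηstar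
  clear hvar hvar' Esq EY Isq IY hsq int_of_mem hmom I1 I2 I3 I4 ha hen hen2 hee h1e hdA
  generalize (∫ ω, Real.exp (-‖x - X ω‖ ^ 2 / t)) = m1 at *
  generalize (∫ ω, Real.exp (-‖x - X ω‖ ^ 2 / (t / 2))) = m2 at *
  generalize (∫ ω, Real.exp (-‖x - X ω‖ ^ 2 / (2 * t / 3))) = m3 at *
  generalize (∫ ω, Real.exp (-‖x - X ω‖ ^ 2 / (2 * t))) = m4 at *
  generalize (2 : ℝ) ^ (ε / 2) = e at *
  generalize (2 : ℝ) ^ ((d : ℝ) / 2) = A at *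
  generalize t ^ ((d : ℝ) / 2) = T at *
  generalize ((2 : ℝ) / 3) ^ ((d : ℝ) / 2) = r at *
  simp only [mul_assoc _ p₀ (Real.pi ^ ((d : ℝ) / 2))] at *
  generalize p₀ * Real.pi ^ ((d : ℝ) / 2) = B at *
  have he0 : 0 < e := by linarith
  have second_moment : (e ^ 2)⁻¹ * Γp * (1 - ηstar) * (A * B * T)
      ≤ (A / e) ^ 2 * m2 - 2 * (A / e) * m3 + m1 := by
    have hprod : Γp * (1 - ηstar)
        = (1 - η) - (1 + η) * (2 * e * r) + (1 - η) * (e ^ 2 / A) := by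
      rw [hηstar, mul_sub, mul_div_cancel₀ _ hΓppos.ne', hΓp]; ring
    calc (e ^ 2)⁻¹ * Γp * (1 - ηstar) * (A * B * T)
        = (A / e) ^ 2 * ((1 - η) * B * (T / A)) - 2 * (A / e) * ((1 + η) * B * (r * T))
          + (1 - η) * B * T := by
          rw [mul_assoc _ Γp, hprod]; field_simp
      _ ≤ _ := by gcongr
  refine ⟨second_moment, sub_le_sub second_moment ?_⟩
  have hηe : η * (1 + e) = c * (e - 1) := by rw [hη]; field_simp
  have hlow : -((1 - e⁻¹) * (1 + c) * (A * B * T)) ≤ A / e * m1 - m4 := by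
    calc -((1 - e⁻¹) * (1 + c) * (A * B * T))
        = A / e * ((1 - η) * B * T) - (1 + η) * B * (A * T) := by
          field_simp; linear_combination hηe
      _ ≤ _ := by gcongr
  have hup : A / e * m1 - m4 ≤ (1 - e⁻¹) * (1 + c) * (A * B * T) := by
    have hneg : 0 ≤ 2 * ((1 - e⁻¹) * (A * B * T)) := by
      have : 0 ≤ 1 - e⁻¹ := sub_nonneg.2 (inv_le_one_of_one_le₀ he1.le)
      positivity
    calc A / e * m1 - m4 ≤ A / e * ((1 + η) * B * T) - (1 - η) * B * (A * T) := by gcongr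
      _ = (1 - e⁻¹) * (1 + c) * (A * B * T) - 2 * ((1 - e⁻¹) * (A * B * T)) := by
          field_simp; linear_combination hηe
      _ ≤ _ := by linarith
  calc _ ≤ ((1 - e⁻¹) * (1 + c) * (A * B * T)) ^ 2 := sq_le_sq' hlow hup
    _ = _ := by ring
end

section
/- Let ε > 0 and η ∈ (0,1/2). Define Δ₊ = (2/3)^{d/2} + 3·2^{d/2−ε/2}·5^{−d/2} + 3·2^{−ε−d} + 2^{−3ε/2−d/2}·3^{−d/2}. If the multiplicative moment bounds with tolerance η hold on H = {t/3, 2t/5, t/2, 2t/3}, then E[|Y₊|³] ≤ (1+η) Δ₊ 2^{d/2 + 3ε/2} P_t. -/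
open MeasureTheory ProbabilityTheory Real

/-- Pointwise bound on the third absolute moment integrand, using the product identity for
Gaussian kernels. -/
theorem abs_gaussian_difference_pow_three_le {a t : ℝ} (ha : 0 ≤ a) (ht : 0 < t) (r : ℝ) :
    |a * Real.exp (-r / t) - Real.exp (-r / (2 * t))| ^ 3
      ≤ a ^ 3 * Real.exp (-r / (t / 3)) + 3 * a ^ 2 * Real.exp (-r / (2 * t / 5))
        + 3 * a * Real.exp (-r / (t / 2)) + Real.exp (-r / (2 * t / 3)) := by
  have h₁ : Real.exp (-r / (t / 3)) = Real.exp (-r / t) ^ 3 := by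
    rw [← Real.exp_nat_mul]; congr 1; push_cast; field_simp
  have h₂ : Real.exp (-r / (2 * t / 5)) = Real.exp (-r / t) ^ 2 * Real.exp (-r / (2 * t)) := by
    rw [← Real.exp_nat_mul, ← Real.exp_add]; congr 1; push_cast; field_simp; ring
  have h₃ : Real.exp (-r / (t / 2)) = Real.exp (-r / t) * Real.exp (-r / (2 * t)) ^ 2 := by
    rw [← Real.exp_nat_mul, ← Real.exp_add]; congr 1; push_cast; field_simp; ring
  have h₄ : Real.exp (-r / (2 * t / 3)) = Real.exp (-r / (2 * t)) ^ 3 := by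
    rw [← Real.exp_nat_mul]; congr 1; push_cast; field_simp
  rw [h₁, h₂, h₃, h₄]
  have hu := (Real.exp_pos (-r / t)).le
  have hv := (Real.exp_pos (-r / (2 * t))).le
  set u := Real.exp (-r / t)
  set v := Real.exp (-r / (2 * t))
  have hau : 0 ≤ a * u := mul_nonneg ha hu
  have habs : |a * u - v| ≤ a * u + v := abs_le.2 ⟨by linarith, by linarith⟩
  calc |a * u - v| ^ 3 ≤ (a * u + v) ^ 3 := by gcongr
    _ = _ := by ring

/-- Third absolute moment bound for `Y₊`.
Let `ε > 0` and `η ∈ (0,1/2)`, and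
`Δ₊ = (2/3)^{d/2} + 3·2^{d/2−ε/2}·5^{−d/2} + 3·2^{−ε−d} + 2^{−3ε/2−d/2}·3^{−d/2}`.
If the multiplicative moment bounds with tolerance `η` hold on
`H = {t/3, 2t/5, t/2, 2t/3}`, then `E[|Y₊|³] ≤ (1+η) Δ₊ 2^{d/2+3ε/2} P_t`, where
`Y₊ = 2^{(d+ε)/2} K_t(x,X) − K_{2t}(x,X)` and `P_t = 2^{d/2} p₀ π^{d/2} t^{d/2}`. -/
theorem Yplus_third_moment_bound
    {N d : ℕ} (hN : 0 < N) (hd : 0 < d)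
    {Ω : Type*} [MeasureSpace Ω] [IsProbabilityMeasure (ℙ : Measure Ω)]
    (X : Ω → EuclideanSpace ℝ (Fin N)) (x : EuclideanSpace ℝ (Fin N))
    (t p₀ ε η : ℝ) (ht : 0 < t) (hp₀ : 0 < p₀) (hε : 0 < ε)
    (hη : η ∈ Set.Ioo (0 : ℝ) (1 / 2))
    (hmom : ∀ s ∈ ({t / 3, 2 * t / 5, t / 2, 2 * t / 3} : Set ℝ),
      (1 - η) * p₀ * Real.pi ^ ((d : ℝ) / 2) * s ^ ((d : ℝ) / 2)
          ≤ ∫ ω, Real.exp (-‖x - X ω‖ ^ 2 / s) ∧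
        ∫ ω, Real.exp (-‖x - X ω‖ ^ 2 / s)
          ≤ (1 + η) * p₀ * Real.pi ^ ((d : ℝ) / 2) * s ^ ((d : ℝ) / 2)) :
    (∫ ω, |(2 : ℝ) ^ (((d : ℝ) + ε) / 2) * Real.exp (-‖x - X ω‖ ^ 2 / t)
          - Real.exp (-‖x - X ω‖ ^ 2 / (2 * t))| ^ 3)
      ≤ (1 + η) *
          (((2 : ℝ) / 3) ^ ((d : ℝ) / 2)
            + 3 * (2 : ℝ) ^ ((d : ℝ) / 2 - ε / 2) * (5 : ℝ) ^ (-(d : ℝ) / 2)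
            + 3 * (2 : ℝ) ^ (-ε - (d : ℝ))
            + (2 : ℝ) ^ (-3 * ε / 2 - (d : ℝ) / 2) * (3 : ℝ) ^ (-(d : ℝ) / 2)) *
          (2 : ℝ) ^ ((d : ℝ) / 2 + 3 * ε / 2) *
          ((2 : ℝ) ^ ((d : ℝ) / 2) * p₀ * Real.pi ^ ((d : ℝ) / 2) * t ^ ((d : ℝ) / 2)) := by
  obtain ⟨hη₀, hη₁⟩ := hη
  have hint : ∀ s ∈ ({t / 3, 2 * t / 5, t / 2, 2 * t / 3} : Set ℝ), 0 < s →
      Integrable (fun ω => Real.exp (-‖x - X ω‖ ^ 2 / s)) (ℙ : Measure Ω) := by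
    intro s hs hs₀
    refine Integrable.of_integral_ne_zero (ne_of_gt (lt_of_lt_of_le ?_ (hmom s hs).1))
    have : 0 < 1 - η := by linarith
    positivity
  have hm₁ : t / 3 ∈ ({t / 3, 2 * t / 5, t / 2, 2 * t / 3} : Set ℝ) := by simp
  have hm₂ : 2 * t / 5 ∈ ({t / 3, 2 * t / 5, t / 2, 2 * t / 3} : Set ℝ) := by simp
  have hm₃ : t / 2 ∈ ({t / 3, 2 * t / 5, t / 2, 2 * t / 3} : Set ℝ) := by simp
  have hm₄ : 2 * t / 3 ∈ ({t / 3, 2 * t / 5, t / 2, 2 * t / 3} : Set ℝ) := by simp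
  set a : ℝ := (2 : ℝ) ^ (((d : ℝ) + ε) / 2) with ha_def
  have ha : 0 ≤ a := by positivity
  have hi₁ := (hint _ hm₁ (by positivity)).const_mul (a ^ 3)
  have hi₂ := (hint _ hm₂ (by positivity)).const_mul (3 * a ^ 2)
  have hi₃ := (hint _ hm₃ (by positivity)).const_mul (3 * a)
  have hi₄ := hint _ hm₄ (by positivity)
  have hle := integral_mono_of_nonneg (μ := (ℙ : Measure Ω))
    (Filter.Eventually.of_forall fun ω => by
      change (0 : ℝ) ≤ |a * Real.exp (-‖x - X ω‖ ^ 2 / t)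
        - Real.exp (-‖x - X ω‖ ^ 2 / (2 * t))| ^ 3
      positivity)
    (((hi₁.add hi₂).add hi₃).add hi₄)
    (Filter.Eventually.of_forall fun ω =>
      abs_gaussian_difference_pow_three_le ha ht (‖x - X ω‖ ^ 2))
  refine hle.trans ?_
  rw [integral_add' ((hi₁.add hi₂).add hi₃) hi₄, integral_add' (hi₁.add hi₂) hi₃,
    integral_add' hi₁ hi₂, integral_const_mul, integral_const_mul, integral_const_mul]
  refine (add_le_add (add_le_add (add_le_add
    (mul_le_mul_of_nonneg_left (hmom _ hm₁).2 (by positivity))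
    (mul_le_mul_of_nonneg_left (hmom _ hm₂).2 (by positivity)))
    (mul_le_mul_of_nonneg_left (hmom _ hm₃).2 (by positivity)))
    (hmom _ hm₄).2).trans (le_of_eq ?_)
  have h2 : (0 : ℝ) < 2 := by norm_num
  have ha_eq : a = (2 : ℝ) ^ ((d : ℝ) / 2) * (2 : ℝ) ^ (ε / 2) := by
    rw [ha_def, add_div, Real.rpow_add h2]
  have hthree : (2 : ℝ) ^ (3 * ε / 2) = ((2 : ℝ) ^ (ε / 2)) ^ 3 := by
    rw [← Real.rpow_mul_natCast h2.le]; congr 1; push_cast; ring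
  have e₁ : (2 : ℝ) ^ (-ε - (d : ℝ))
      = (((2 : ℝ) ^ (ε / 2)) ^ 2 * ((2 : ℝ) ^ ((d : ℝ) / 2)) ^ 2)⁻¹ := by
    rw [← Real.rpow_mul_natCast h2.le, ← Real.rpow_mul_natCast h2.le, ← Real.rpow_add h2,
      ← Real.rpow_neg h2.le]
    congr 1; push_cast; ring
  have e₂ : (2 : ℝ) ^ (-3 * ε / 2 - (d : ℝ) / 2)
      = (((2 : ℝ) ^ (ε / 2)) ^ 3 * (2 : ℝ) ^ ((d : ℝ) / 2))⁻¹ := by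
    rw [← hthree, ← Real.rpow_add h2, ← Real.rpow_neg h2.le]
    congr 1; ring
  rw [ha_eq, e₁, e₂, Real.rpow_sub h2, Real.rpow_add h2, hthree, neg_div,
    Real.rpow_neg (by norm_num), Real.rpow_neg (by norm_num),
    Real.div_rpow ht.le (by norm_num), Real.div_rpow ht.le (by norm_num),
    Real.div_rpow (by positivity) (by norm_num), Real.div_rpow (by positivity) (by norm_num),
    Real.mul_rpow h2.le ht.le, Real.div_rpow h2.le (by norm_num)]
  have hD : (0 : ℝ) < (2 : ℝ) ^ ((d : ℝ) / 2) := by positivity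
  have hE : (0 : ℝ) < (2 : ℝ) ^ (ε / 2) := by positivity
  have hF : (0 : ℝ) < (3 : ℝ) ^ ((d : ℝ) / 2) := by positivity
  have hV : (0 : ℝ) < (5 : ℝ) ^ ((d : ℝ) / 2) := by positivity
  generalize (2 : ℝ) ^ ((d : ℝ) / 2) = D at *
  generalize (2 : ℝ) ^ (ε / 2) = E at *
  generalize (3 : ℝ) ^ ((d : ℝ) / 2) = F at *
  generalize (5 : ℝ) ^ ((d : ℝ) / 2) = V at *
  field_simp
end

section
/- Let ε > 0 and η ∈ (0,1/2). Define Δ₋ = (2/3)^{d/2} + 3·2^{d/2+ε/2}·5^{−d/2} + 3·2^{ε−d} + 2^{3ε/2−d/2}·3^{−d/2}. If the multiplicative moment bounds with tolerance η hold on H = {t/3, 2t/5, t/2, 2t/3}, then E[|Y₋|³] ≤ (1+η) Δ₋ 2^{d/2 − 3ε/2} P_t. -/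
open MeasureTheory ProbabilityTheory Real

/-- The cube of a difference of nonnegative reals is at most the expanded cube of their sum. -/
lemma abs_sub_pow_three_le {a b : ℝ} (ha : 0 ≤ a) (hb : 0 ≤ b) :
    |a - b| ^ 3 ≤ a ^ 3 + 3 * a ^ 2 * b + 3 * a * b ^ 2 + b ^ 3 := by
  have h : |a - b| ≤ a + b := abs_le.2 ⟨by linarith, by linarith⟩
  calc |a - b| ^ 3 ≤ (a + b) ^ 3 := by gcongr
    _ = _ := by ring

/-- Products of Gaussian kernels of bandwidths `t` and `2 * t` are Gaussian kernels, so the third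
absolute moment of a combination is controlled by first moments at four smaller bandwidths. -/
lemma abs_mul_exp_sub_exp_pow_three_le {c t : ℝ} (hc : 0 ≤ c) (ht : t ≠ 0) (r : ℝ) :
    |c * exp (-r / t) - exp (-r / (2 * t))| ^ 3 ≤
      c ^ 3 * exp (-r / (t / 3)) + 3 * c ^ 2 * exp (-r / (2 * t / 5))
        + 3 * c * exp (-r / (t / 2)) + exp (-r / (2 * t / 3)) := by
  refine (abs_sub_pow_three_le (mul_nonneg hc (exp_pos _).le) (exp_pos _).le).trans_eq ?_
  have h₁ : exp (-r / (t / 3)) = exp (-r / t) ^ 3 := by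
    rw [← exp_nat_mul]; congr 1; push_cast; field_simp
  have h₂ : exp (-r / (2 * t / 5)) = exp (-r / t) ^ 2 * exp (-r / (2 * t)) := by
    rw [← exp_nat_mul, ← exp_add]; congr 1; push_cast; field_simp; ring
  have h₃ : exp (-r / (t / 2)) = exp (-r / t) * exp (-r / (2 * t)) ^ 2 := by
    rw [← exp_nat_mul, ← exp_add]; congr 1; push_cast; field_simp; ring
  have h₄ : exp (-r / (2 * t / 3)) = exp (-r / (2 * t)) ^ 3 := by
    rw [← exp_nat_mul]; congr 1; push_cast; field_simp
  rw [h₁, h₂, h₃, h₄]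
  ring

/-- The constant obtained by expanding the cube factors through `2 ^ (d / 2 - 3 * ε / 2)`. -/
lemma third_moment_constant_eq {t : ℝ} (ht : 0 < t) (d ε : ℝ) :
    ((2 : ℝ) ^ ((d - ε) / 2)) ^ 3 * (t / 3) ^ (d / 2)
        + 3 * ((2 : ℝ) ^ ((d - ε) / 2)) ^ 2 * (2 * t / 5) ^ (d / 2)
        + 3 * (2 : ℝ) ^ ((d - ε) / 2) * (t / 2) ^ (d / 2) + (2 * t / 3) ^ (d / 2) =
      (((2 : ℝ) / 3) ^ (d / 2)
        + 3 * (2 : ℝ) ^ (d / 2 + ε / 2) * (5 : ℝ) ^ (-d / 2)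
        + 3 * (2 : ℝ) ^ (ε - d)
        + (2 : ℝ) ^ (3 * ε / 2 - d / 2) * (3 : ℝ) ^ (-d / 2)) *
      (2 : ℝ) ^ (d / 2 - 3 * ε / 2) * ((2 : ℝ) ^ (d / 2) * t ^ (d / 2)) := by
  obtain ⟨u, rfl⟩ : ∃ u, d = 2 * u := ⟨d / 2, by ring⟩
  obtain ⟨v, rfl⟩ : ∃ v, ε = 2 * v := ⟨ε / 2, by ring⟩
  have two : (0 : ℝ) < 2 := two_pos
  have h₁ : (2 * u - 2 * v) / 2 = u - v := by ring
  have h₂ : 2 * u / 2 = u := by ring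
  have h₃ : 2 * v / 2 = v := by ring
  have h₄ : -(2 * u) / 2 = -u := by ring
  have h₅ : 2 * v - 2 * u = v * (2 : ℕ) - u * (2 : ℕ) := by push_cast; ring
  have h₆ : 3 * (2 * v) / 2 = v * (3 : ℕ) := by push_cast; ring
  rw [h₁, h₂, h₃, h₄, h₅, h₆]
  simp only [rpow_sub two, rpow_add two, rpow_mul_natCast two.le]
  rw [rpow_neg (by norm_num : (0 : ℝ) ≤ 5), rpow_neg (by norm_num : (0 : ℝ) ≤ 3),
    div_rpow ht.le (by norm_num), div_rpow (by positivity) (by norm_num),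
    div_rpow ht.le (by norm_num), div_rpow (by positivity) (by norm_num),
    div_rpow (by norm_num) (by norm_num), mul_rpow two.le ht.le]
  have := rpow_pos_of_pos two u
  have := rpow_pos_of_pos two v
  have := rpow_pos_of_pos (show (0 : ℝ) < 3 by norm_num) u
  have := rpow_pos_of_pos (show (0 : ℝ) < 5 by norm_num) u
  field_simp

/-- Third absolute moment bound for `Y₋`.
Let `ε > 0` and `η ∈ (0,1/2)`, and
`Δ₋ = (2/3)^{d/2} + 3·2^{d/2+ε/2}·5^{−d/2} + 3·2^{ε−d} + 2^{3ε/2−d/2}·3^{−d/2}`.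
If the multiplicative moment bounds with tolerance `η` hold on
`H = {t/3, 2t/5, t/2, 2t/3}`, then `E[|Y₋|³] ≤ (1+η) Δ₋ 2^{d/2−3ε/2} P_t`, where
`Y₋ = 2^{(d−ε)/2} K_t(x,X) − K_{2t}(x,X)` and `P_t = 2^{d/2} p₀ π^{d/2} t^{d/2}`. -/
theorem Yminus_third_moment_bound
    {N d : ℕ} (hN : 0 < N) (hd : 0 < d)
    {Ω : Type*} [MeasureSpace Ω] [IsProbabilityMeasure (ℙ : Measure Ω)]
    (X : Ω → EuclideanSpace ℝ (Fin N)) (x : EuclideanSpace ℝ (Fin N))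
    (t p₀ ε η : ℝ) (ht : 0 < t) (hp₀ : 0 < p₀) (hε : 0 < ε)
    (hη : η ∈ Set.Ioo (0 : ℝ) (1 / 2))
    (hmom : ∀ s ∈ ({t / 3, 2 * t / 5, t / 2, 2 * t / 3} : Set ℝ),
      (1 - η) * p₀ * Real.pi ^ ((d : ℝ) / 2) * s ^ ((d : ℝ) / 2)
          ≤ ∫ ω, Real.exp (-‖x - X ω‖ ^ 2 / s) ∧
        ∫ ω, Real.exp (-‖x - X ω‖ ^ 2 / s)
          ≤ (1 + η) * p₀ * Real.pi ^ ((d : ℝ) / 2) * s ^ ((d : ℝ) / 2)) :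
    (∫ ω, |(2 : ℝ) ^ (((d : ℝ) - ε) / 2) * Real.exp (-‖x - X ω‖ ^ 2 / t)
          - Real.exp (-‖x - X ω‖ ^ 2 / (2 * t))| ^ 3)
      ≤ (1 + η) *
          (((2 : ℝ) / 3) ^ ((d : ℝ) / 2)
            + 3 * (2 : ℝ) ^ ((d : ℝ) / 2 + ε / 2) * (5 : ℝ) ^ (-(d : ℝ) / 2)
            + 3 * (2 : ℝ) ^ (ε - (d : ℝ))
            + (2 : ℝ) ^ (3 * ε / 2 - (d : ℝ) / 2) * (3 : ℝ) ^ (-(d : ℝ) / 2)) *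
          (2 : ℝ) ^ ((d : ℝ) / 2 - 3 * ε / 2) *
          ((2 : ℝ) ^ ((d : ℝ) / 2) * p₀ * Real.pi ^ ((d : ℝ) / 2) * t ^ ((d : ℝ) / 2)) := by
  have integrable_kernel (s : ℝ) (hs : 0 < s)
      (h : (1 - η) * p₀ * Real.pi ^ ((d : ℝ) / 2) * s ^ ((d : ℝ) / 2)
        ≤ ∫ ω, Real.exp (-‖x - X ω‖ ^ 2 / s)) :
      Integrable fun ω ↦ Real.exp (-‖x - X ω‖ ^ 2 / s) := by
    have hη' : 0 < 1 - η := by linarith [hη.2]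
    refine .of_integral_ne_zero (ne_of_gt (lt_of_lt_of_le ?_ h))
    positivity
  obtain ⟨l₁, u₁⟩ := hmom (t / 3) (by simp)
  obtain ⟨l₂, u₂⟩ := hmom (2 * t / 5) (by simp)
  obtain ⟨l₃, u₃⟩ := hmom (t / 2) (by simp)
  obtain ⟨l₄, u₄⟩ := hmom (2 * t / 3) (by simp)
  set c : ℝ := (2 : ℝ) ^ (((d : ℝ) - ε) / 2) with hc_def
  have hc : 0 ≤ c := by positivity
  have i₁ := (integrable_kernel _ (by positivity) l₁).const_mul (c ^ 3)
  have i₂ := (integrable_kernel _ (by positivity) l₂).const_mul (3 * c ^ 2)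
  have i₃ := (integrable_kernel _ (by positivity) l₃).const_mul (3 * c)
  have i₄ := integrable_kernel _ (by positivity) l₄
  have hconst := third_moment_constant_eq ht (d : ℝ) ε
  rw [← hc_def] at hconst
  calc
    _ ≤ ∫ ω, (c ^ 3 * Real.exp (-‖x - X ω‖ ^ 2 / (t / 3))
          + 3 * c ^ 2 * Real.exp (-‖x - X ω‖ ^ 2 / (2 * t / 5))
          + 3 * c * Real.exp (-‖x - X ω‖ ^ 2 / (t / 2))
          + Real.exp (-‖x - X ω‖ ^ 2 / (2 * t / 3))) :=
      integral_mono_of_nonneg (.of_forall fun _ ↦ by positivity) (((i₁.add i₂).add i₃).add i₄)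
        (.of_forall fun _ ↦ abs_mul_exp_sub_exp_pow_three_le hc ht.ne' _)
    _ = c ^ 3 * (∫ ω, Real.exp (-‖x - X ω‖ ^ 2 / (t / 3)))
          + 3 * c ^ 2 * (∫ ω, Real.exp (-‖x - X ω‖ ^ 2 / (2 * t / 5)))
          + 3 * c * (∫ ω, Real.exp (-‖x - X ω‖ ^ 2 / (t / 2)))
          + ∫ ω, Real.exp (-‖x - X ω‖ ^ 2 / (2 * t / 3)) := by
      rw [integral_add (by fun_prop) i₄, integral_add (by fun_prop) i₃, integral_add i₁ i₂]
      simp only [integral_const_mul]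
    _ ≤ c ^ 3 * ((1 + η) * p₀ * Real.pi ^ ((d : ℝ) / 2) * (t / 3) ^ ((d : ℝ) / 2))
          + 3 * c ^ 2 * ((1 + η) * p₀ * Real.pi ^ ((d : ℝ) / 2) * (2 * t / 5) ^ ((d : ℝ) / 2))
          + 3 * c * ((1 + η) * p₀ * Real.pi ^ ((d : ℝ) / 2) * (t / 2) ^ ((d : ℝ) / 2))
          + (1 + η) * p₀ * Real.pi ^ ((d : ℝ) / 2) * (2 * t / 3) ^ ((d : ℝ) / 2) := by
      gcongr
    _ = _ := by
      linear_combination (1 + η) * p₀ * Real.pi ^ ((d : ℝ) / 2) * hconst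
end
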